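/- In any execution of the coding scheme Π (Algorithms 1–2) on inputs (x,y) with an arbitrary erasure pattern, for every round i with 2 ≤ i ≤ t_A+1: if r_B(i) = r_A(i)+1, then r_A(i) = r_A(i−1). -/

import Mathlib

/-!
Model of the coding scheme Π (Algorithms 1–2) of "Interactive coding resilient to an
unknown number of erasures".  A noiseless alternating binary protocol `π` of length `N`
is given by next-bit functions `fA fB : List Bool → Bool` (`fA t = π(x∣t)` on
even-length transcripts `t`, `fB t = π(y∣t)` on odd-length transcripts `t`).
Rounds are 1-indexed; round `i` consists of two timesteps whose erasures are given by
`(E i).1` (odd timestep, Alice → Bob) and `(E i).2` (even timestep, Bob → Alice).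
-/

namespace Scheme1

/-- Parity of a round number, as a Boolean. -/
def par (r : ℕ) : Bool := decide (r % 2 = 1)

/-- The joint state of Alice and Bob at the beginning of a round:
Alice's partial transcript `TA` and round counter `rA`; Bob's partial transcript `TB`,
round counter `rB`, error flag `err` and stored message `m = (bit, parity)`. -/
structure St where
  TA : List Bool
  rA : ℕ
  TB : List Bool
  rB : ℕ
  err : Bool
  m : Bool × Bool
deriving DecidableEq

/-- The initial state. -/
def init : St := ⟨[], 0, [], 0, false, (false, false)⟩

/-- The information bit `b_B(i)` Bob sends in a round, given the erasure `e1` of the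
round's odd timestep and the state `s` at the beginning of the round. -/
def bobSentBit (fA fB : List Bool → Bool) (e1 : Bool) (s : St) : Bool :=
  let b := fA s.TA
  let bobErr : Bool := e1 || (par (s.rA + 1) == par s.rB)
  if bobErr then s.m.1 else fB (s.TB ++ [b])

/-- One round of the coding scheme Π of Algorithms 1–2; `e.1`/`e.2` tell whether the
odd/even timestep of the round is erased.  After Alice terminates (`rA = N/2`) the
recorded state no longer changes (Bob only resends his stored message upon erasures,
and terminates upon hearing silence). -/
def step (fA fB : List Bool → Bool) (N : ℕ) (e : Bool × Bool) (s : St) : St :=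
  if s.rA < N / 2 then
    -- odd timestep: Alice extends and sends (b, parity)
    let b := fA s.TA
    let rA1 := s.rA + 1
    -- Bob receives (⊥ if e.1)
    let bobErr : Bool := e.1 || (par rA1 == par s.rB)
    let TB' := if bobErr then s.TB else (s.TB ++ [b]) ++ [fB (s.TB ++ [b])]
    let rB' := if bobErr then s.rB else s.rB + 1
    let m' := if bobErr then s.m else (fB (s.TB ++ [b]), par (s.rB + 1))
    -- even timestep: Bob sends m'; Alice receives (⊥ if e.2)
    let aliceOk : Bool := !e.2 && (m'.2 == par rA1)
    let TA' := if aliceOk then (s.TA ++ [b]) ++ [m'.1] else s.TA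
    let rA' := if aliceOk then rA1 else s.rA
    ⟨TA', rA', TB', rB', bobErr, m'⟩
  else s

/-- `exec fA fB N E k` is the state after `k` rounds have been played. -/
def exec (fA fB : List Bool → Bool) (N : ℕ) (E : ℕ → Bool × Bool) : ℕ → St
  | 0 => init
  | k + 1 => step fA fB N (E (k + 1)) (exec fA fB N E k)

/-- `stAt fA fB N E i` is the state at the beginning of round `i` (rounds 1-indexed):
for a protocol variable `v`, `v(i) = (stAt … i).v`. -/
def stAt (fA fB : List Bool → Bool) (N : ℕ) (E : ℕ → Bool × Bool) (i : ℕ) : St :=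
  exec fA fB N E (i - 1)

/-- The noiseless transcript of `π` after `r` rounds; `transcript fA fB (N/2)` is `T^π`. -/
def transcript (fA fB : List Bool → Bool) : ℕ → List Bool
  | 0 => []
  | r + 1 =>
    let t := transcript fA fB r
    (t ++ [fA t]) ++ [fB (t ++ [fA t])]

/-- The two parties are in step or Bob is one round ahead, and Bob's stored message carries
the parity of his counter. -/
def Synced (s : St) : Prop :=
  s.m.2 = par s.rB ∧ (s.rB = s.rA ∨ s.rB = s.rA + 1)

theorem par_succ (r : ℕ) : par (r + 1) = !par r := by
  rcases Nat.mod_two_eq_zero_or_one r with h | h <;> simp [par, Nat.add_mod, h]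

theorem synced_step (fA fB : List Bool → Bool) (N : ℕ) (e : Bool × Bool) {s : St}
    (hs : Synced s) :
    Synced (step fA fB N e s) ∧
      ((step fA fB N e s).rB = (step fA fB N e s).rA + 1 → (step fA fB N e s).rA = s.rA) := by
  obtain ⟨TA, rA, TB, rB, err, b, p⟩ := s
  obtain ⟨e1, e2⟩ := e
  simp only [Synced] at hs
  by_cases h : rA < N / 2 <;> obtain ⟨rfl, rfl | rfl⟩ := hs <;>
    cases e1 <;> cases e2 <;> simp [Synced, step, h, par_succ]

theorem synced_exec (fA fB : List Bool → Bool) (N : ℕ) (E : ℕ → Bool × Bool) (k : ℕ) :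
    Synced (exec fA fB N E k) := by
  induction k with
  | zero => simp [Synced, exec, init, par]
  | succ k ih => exact (synced_step fA fB N (E (k + 1)) ih).1

/-- Claim 5 of the paper.  In any execution of Π, for every round
`2 ≤ i ≤ t_A + 1`: if `r_B(i) = r_A(i) + 1` then `r_A(i) = r_A(i-1)`. -/
theorem scheme1_rA_unchanged
    (fA fB : List Bool → Bool) (N : ℕ) (hN : 0 < N) (hNeven : Even N)
    (E : ℕ → Bool × Bool) (tA : ℕ)
    (htA1 : ∀ i, 1 ≤ i → i ≤ tA → (stAt fA fB N E i).rA < N / 2)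
    (htA2 : (stAt fA fB N E (tA + 1)).rA = N / 2)
    (i : ℕ) (hi1 : 2 ≤ i) (hi2 : i ≤ tA + 1)
    (hshift : (stAt fA fB N E i).rB = (stAt fA fB N E i).rA + 1) :
    (stAt fA fB N E i).rA = (stAt fA fB N E (i - 1)).rA := by
  obtain ⟨k, rfl⟩ := Nat.exists_eq_add_of_le' hi1
  exact (synced_step fA fB N (E (k + 1)) (synced_exec fA fB N E k)).2 hshift

end Scheme1
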